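/- arXiv:1808.10474 — 3 statements merged into one kernel-verified Lean document; each statement's English description precedes it below -/
import Mathlib

section
/- Let f satisfy the strong-convexity bound ⟪v, ∇²f(x) v⟫ ≥ k‖v‖² (k > 0) and let x* be its unique critical point. Let x : ℝ → ℝⁿ be any trajectory of the rescaled gradient flow ẋ = −∇f(x)/‖∇f(x)‖^{1/2} (right-hand side taken to be 0 when ∇f(x) = 0). Then x(t) = x* for every t ≥ 2‖∇f(x(0))‖^{1/2}/k; in particular the trajectory reaches the minimizer in finite time. -/
open scoped RealInnerProductSpace Classical

theorem aux_antitone (u u' : ℝ → ℝ) (T : ℝ) (hT : 0 ≤ T)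
    (h : ∀ t, 0 ≤ t → t ≤ T → HasDerivAt u (u' t) t ∧ u' t ≤ 0) : 
    AntitoneOn u (Set.Icc 0 T) := by
  apply antitoneOn_of_deriv_nonpos (convex_Icc 0 T)
  · intro t ht
    exact (h t ht.1 ht.2).1.continuousAt.continuousWithinAt
  · intro t ht
    rw [interior_Icc] at ht
    exact (h t ht.1.le ht.2.le).1.differentiableAt.differentiableWithinAt
  · intro t ht
    rw [interior_Icc] at ht
    rw [(h t ht.1.le ht.2.le).1.deriv]
    exact (h t ht.1.le ht.2.le).2

/-- Rescaled gradient flow `ẋ = −∇f(x)/‖∇f(x)‖^{1/2}` reaches the unique critical point `x*`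
of a strongly convex `f` in finite time `2‖∇f(x(0))‖^{1/2}/k`. -/
theorem rescaled_gradient_flow_finite_time_strong_convex
    {n : ℕ} (f : EuclideanSpace ℝ (Fin n) → ℝ) (hf : ContDiff ℝ 2 f)
    (k : ℝ) (hk : 0 < k)
    (hconv : ∀ x v : EuclideanSpace ℝ (Fin n),
      k * ‖v‖ ^ 2 ≤ ⟪v, fderiv ℝ (gradient f) x v⟫)
    (xstar : EuclideanSpace ℝ (Fin n)) (hxstar : gradient f xstar = 0)
    (x : ℝ → EuclideanSpace ℝ (Fin n))
    (hx : ∀ t : ℝ, 0 ≤ t → HasDerivAt x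
      (if gradient f (x t) = 0 then 0
       else -(‖gradient f (x t)‖ ^ ((1 : ℝ) / 2))⁻¹ • gradient f (x t)) t) :
    ∀ t : ℝ, 2 * ‖gradient f (x 0)‖ ^ ((1 : ℝ) / 2) / k ≤ t → x t = xstar := by
  intro T hT
  have hGd : Differentiable ℝ (gradient f) := by
    have h1 : ContDiff ℝ 1 (fderiv ℝ f) := hf.fderiv_right (by norm_num)
    have h2 := h1.differentiable (by norm_num)
    exact (InnerProductSpace.toDual ℝ
      (EuclideanSpace ℝ (Fin n))).symm.toContinuousLinearEquiv.differentiable.comp h2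
  have hT0 : 0 ≤ T := le_trans (by positivity) hT
  have huniq : ∀ y, gradient f y = 0 → y = xstar := by
    intro y hy
    set v := y - xstar with hv
    have hd : ∀ s : ℝ, 0 ≤ s → s ≤ 1 →
        HasDerivAt (fun s : ℝ => k * ‖v‖ ^ 2 * s - ⟪v, gradient f (xstar + s • v)⟫)
          (k * ‖v‖ ^ 2 - ⟪v, fderiv ℝ (gradient f) (xstar + s • v) v⟫) s ∧
        k * ‖v‖ ^ 2 - ⟪v, fderiv ℝ (gradient f) (xstar + s • v) v⟫ ≤ 0 := by
      intro s _ _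
      refine ⟨?_, by linarith [hconv (xstar + s • v) v]⟩
      have h1 : HasDerivAt (fun s : ℝ => xstar + s • v) v s := by
        simpa using ((hasDerivAt_id s).smul_const v).const_add xstar
      have h2 := (hGd (xstar + s • v)).hasFDerivAt.comp_hasDerivAt s h1
      have h3 := (hasDerivAt_const s v).inner ℝ h2
      have h4 := ((hasDerivAt_id s).const_mul (k * ‖v‖ ^ 2)).sub h3
      refine h4.congr_deriv ?_
      simp
    have ha := aux_antitone _ _ 1 zero_le_one hd (Set.left_mem_Icc.2 zero_le_one)
      (Set.right_mem_Icc.2 zero_le_one) zero_le_one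
    have e1 : xstar + v = y := by rw [hv]; abel
    simp [e1, hy, hxstar] at ha
    have h5 : ‖v‖ ^ 2 ≤ 0 := by
      by_contra hc
      push Not at hc
      nlinarith [mul_pos hk hc]
    have h6 : ‖v‖ = 0 := by nlinarith [norm_nonneg v]
    exact sub_eq_zero.1 (norm_eq_zero.1 h6)
  apply huniq
  by_contra hne
  obtain ⟨N', hN'⟩ : ∃ N' : ℝ → ℝ, ∀ t, 0 ≤ t →
      HasDerivAt (fun t => ‖gradient f (x t)‖ ^ 2) (N' t) t ∧
      N' t ≤ -2 * k * √‖gradient f (x t)‖ ^ 3 := by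
    refine ⟨fun t => 2 * ⟪gradient f (x t), fderiv ℝ (gradient f) (x t)
      (if gradient f (x t) = 0 then 0
       else -(‖gradient f (x t)‖ ^ ((1 : ℝ) / 2))⁻¹ • gradient f (x t))⟫, ?_⟩
    intro t ht
    refine ⟨((hGd (x t)).hasFDerivAt.comp_hasDerivAt t (hx t ht)).norm_sq, ?_⟩
    by_cases h0 : gradient f (x t) = 0
    · simp [h0]
    · beta_reduce
      rw [if_neg h0, ← Real.sqrt_eq_rpow]
      have hc := hconv (x t) (gradient f (x t))
      have hr : 0 < ‖gradient f (x t)‖ := norm_pos_iff.2 h0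
      have hs := Real.sqrt_pos.2 hr
      have hss := Real.sq_sqrt hr.le
      rw [map_smul, inner_smul_right]
      set s := √‖gradient f (x t)‖
      rw [← hss] at hc
      have h7 := mul_le_mul_of_nonneg_left hc (inv_pos.2 hs).le
      have h8 : s⁻¹ * (k * (s ^ 2) ^ 2) = k * s ^ 3 := by field_simp
      rw [h8] at h7
      linarith
  have hanti := aux_antitone _ N' T hT0 (fun t h0 _ => ⟨(hN' t h0).1, (hN' t h0).2.trans (by
    have : 0 ≤ k * √‖gradient f (x t)‖ ^ 3 := by positivity
    linarith)⟩)
  have hpos : ∀ t, 0 ≤ t → t ≤ T → 0 < ‖gradient f (x t)‖ := by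
    intro t h0 h1
    have h2 := hanti ⟨h0, h1⟩ (Set.right_mem_Icc.2 hT0) h1
    have h3 : 0 < ‖gradient f (x T)‖ ^ 2 := by
      have := norm_pos_iff.2 hne
      positivity
    exact lt_of_le_of_ne (norm_nonneg _) (fun h => by
      have h4 := h3.trans_le h2
      simp [← h] at h4)
  have hfin := aux_antitone (fun t => √(√(‖gradient f (x t)‖ ^ 2)) + k / 2 * t)
    (fun t => N' t / (2 * √(‖gradient f (x t)‖ ^ 2)) / (2 * √(√(‖gradient f (x t)‖ ^ 2))) + k / 2)
    T hT0 (by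
      intro t h0 h1
      have hr := hpos t h0 h1
      obtain ⟨hd, hle⟩ := hN' t h0
      constructor
      · have h2 := (hd.sqrt (by positivity)).sqrt (by positivity)
        refine (h2.add ((hasDerivAt_id t).const_mul (k / 2))).congr_deriv ?_
        simp
      · rw [Real.sqrt_sq hr.le]
        have hs := Real.sqrt_pos.2 hr
        have hss := Real.sq_sqrt hr.le
        set s := √‖gradient f (x t)‖
        rw [← hss, div_div]
        have : N' t / (2 * s ^ 2 * (2 * s)) ≤ -(k / 2) := by
          rw [div_le_iff₀ (by positivity)]
          linarith
        linarith)
  have h9 := hfin (Set.left_mem_Icc.2 hT0) (Set.right_mem_Icc.2 hT0) hT0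
  simp only [Real.sqrt_sq (norm_nonneg _)] at h9
  rw [← Real.sqrt_eq_rpow, div_le_iff₀ hk] at hT
  have h10 := Real.sqrt_pos.2 (hpos T hT0 le_rfl)
  linarith
end

section
/- Fix c₁, c₂ > 0, p₁ > 2, 1 < p₂ < 2, and set α₁ = 2 − (p₁−2)/(p₁−1) ∈ (1,2) and α₂ = 2 − (p₂−2)/(p₂−1) > 2. Let f be twice continuously differentiable with ∇²f(x) invertible for every x, and suppose x* is the unique point where ∇f vanishes. Let x : ℝ → ℝⁿ be any trajectory of the modified Newton flow ẋ = −(∇²f(x))⁻¹ (c₁∇f(x)/‖∇f(x)‖^{(p₁−2)/(p₁−1)} + c₂∇f(x)/‖∇f(x)‖^{(p₂−2)/(p₂−1)}) (right-hand side taken to be 0 when ∇f(x) = 0). Then, regardless of the initial condition x(0), x(t) = x* for every t ≥ T_NM := 2^{1−α₁/2}/(c₁(2−α₁)) + 2^{1−α₂/2}/(c₂(α₂−2)). -/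
open scoped RealInnerProductSpace Classical

lemma aux_fixed_time (N : ℝ → ℝ) (c₁ c₂ b₁ b₂ : ℝ) (hc₁ : 0 < c₁) (hc₂ : 0 < c₂)
    (hb₁ : 0 < b₁) (hb₂ : b₂ < 0) (hN : ∀ t, 0 ≤ N t)
    (hd : ∀ t, 0 ≤ t → ∃ d, HasDerivAt N d t ∧ d ≤ 0 ∧ (0 < N t →
      d ≤ -2 * c₁ * N t ^ (1 - b₁ / 2) ∧ d ≤ -2 * c₂ * N t ^ (1 - b₂ / 2)))
    (t : ℝ) (ht : 2 ^ (b₁ / 2) / (c₁ * b₁) + 2 ^ (b₂ / 2) / (c₂ * (-b₂)) ≤ t) : N t = 0 := by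
  by_contra hne
  have hpos : 0 < N t := lt_of_le_of_ne (hN t) (Ne.symm hne)
  choose! d hd1 hd2 hd3 using hd
  have hanti : AntitoneOn N (Set.Ici 0) := by
    apply antitoneOn_of_hasDerivWithinAt_nonpos (convex_Ici 0) (f' := d)
    · intro s hs
      exact (hd1 s hs).continuousAt.continuousWithinAt
    · intro s hs
      exact (hd1 s (interior_subset hs)).hasDerivWithinAt
    · intro s hs
      exact hd2 s (interior_subset hs)
  have hT1 : 0 < 2 ^ (b₁ / 2) / (c₁ * b₁) := by positivity
  have hT2 : 0 < 2 ^ (b₂ / 2) / (c₂ * (-b₂)) := by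
    have : 0 < -b₂ := by linarith
    positivity
  set T1 := 2 ^ (b₁ / 2) / (c₁ * b₁) with hT1d
  set T2 := 2 ^ (b₂ / 2) / (c₂ * (-b₂)) with hT2d
  have ht0 : 0 ≤ t := by linarith
  have hNp : ∀ s ∈ Set.Icc 0 t, 0 < N s := fun s hs =>
    lt_of_lt_of_le hpos (hanti hs.1 ht0 hs.2)
  have hder : ∀ b : ℝ, ∀ s ∈ Set.Icc 0 t,
      HasDerivAt (fun u => N u ^ (b / 2)) (d s * (b / 2) * N s ^ (b / 2 - 1)) s := fun b s hs =>
    (hd1 s hs.1).rpow_const (Or.inl (hNp s hs).ne')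
  have hmul : ∀ b : ℝ, ∀ s ∈ Set.Icc 0 t, N s ^ (1 - b / 2) * N s ^ (b / 2 - 1) = 1 := by
    intro b s hs
    rw [← Real.rpow_add (hNp s hs)]
    simp
  -- phase two quantity
  have h1 : AntitoneOn (fun u => N u ^ (b₁ / 2) + c₁ * b₁ * u) (Set.Icc 0 t) := by
    apply antitoneOn_of_hasDerivWithinAt_nonpos (convex_Icc 0 t)
      (f' := fun s => d s * (b₁ / 2) * N s ^ (b₁ / 2 - 1) + c₁ * b₁ * 1)
    · intro s hs
      exact ((hder b₁ s hs).add ((hasDerivAt_id s).const_mul (c₁ * b₁))).continuousAt.continuousWithinAt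
    · intro s hs
      exact ((hder b₁ s (interior_subset hs)).add
        ((hasDerivAt_id s).const_mul (c₁ * b₁))).hasDerivWithinAt
    · intro s hs
      have hs := interior_subset hs
      have e := (hd3 s hs.1 (hNp s hs)).1
      have m := hmul b₁ s hs
      have q : 0 < N s ^ (b₁ / 2 - 1) := Real.rpow_pos_of_pos (hNp s hs) _
      have := mul_le_mul_of_nonneg_right e (mul_pos (half_pos hb₁) q).le
      linear_combination this + c₁ * b₁ * (-m)
  have h2 : MonotoneOn (fun u => N u ^ (b₂ / 2) + c₂ * b₂ * u) (Set.Icc 0 t) := by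
    apply monotoneOn_of_hasDerivWithinAt_nonneg (convex_Icc 0 t)
      (f' := fun s => d s * (b₂ / 2) * N s ^ (b₂ / 2 - 1) + c₂ * b₂ * 1)
    · intro s hs
      exact ((hder b₂ s hs).add ((hasDerivAt_id s).const_mul (c₂ * b₂))).continuousAt.continuousWithinAt
    · intro s hs
      exact ((hder b₂ s (interior_subset hs)).add
        ((hasDerivAt_id s).const_mul (c₂ * b₂))).hasDerivWithinAt
    · intro s hs
      have hs := interior_subset hs
      have e := (hd3 s hs.1 (hNp s hs)).2
      have m := hmul b₂ s hs
      have q : 0 < N s ^ (b₂ / 2 - 1) := Real.rpow_pos_of_pos (hNp s hs) _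
      have := mul_le_mul_of_nonneg_right e (mul_pos (show 0 < -b₂ / 2 by linarith) q).le
      linear_combination this + c₂ * b₂ * m
  have m0 : (0:ℝ) ∈ Set.Icc 0 t := ⟨le_rfl, ht0⟩
  have m2 : T2 ∈ Set.Icc 0 t := ⟨hT2.le, by linarith⟩
  have m3 : T2 + T1 ∈ Set.Icc 0 t := ⟨by linarith, by linarith⟩
  have k2 := h2 m0 m2 hT2.le
  have k1 := h1 m2 m3 (by linarith)
  simp only [mul_zero, add_zero] at k1 k2
  have e2 : c₂ * b₂ * T2 = - 2 ^ (b₂ / 2) := by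
    have hb : b₂ ≠ 0 := hb₂.ne
    rw [hT2d]; field_simp
  have e1 : c₁ * b₁ * T1 = 2 ^ (b₁ / 2) := by
    rw [hT1d]; field_simp
  have p0 : 0 < N 0 ^ (b₂ / 2) := Real.rpow_pos_of_pos (hNp 0 m0) _
  have p3 : 0 < N (T2 + T1) ^ (b₁ / 2) := Real.rpow_pos_of_pos (hNp _ m3) _
  have lt2 : N T2 < 2 := by
    by_contra hcon
    push Not at hcon
    have := Real.rpow_le_rpow_of_nonpos (by norm_num) hcon (show b₂ / 2 ≤ 0 by linarith)
    linarith
  have := Real.rpow_le_rpow (hN T2) lt2.le (show 0 ≤ b₁ / 2 by linarith)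
  linarith

/-- The modified Newton flow
`ẋ = −(∇²f(x))⁻¹(c₁∇f/‖∇f‖^{(p₁−2)/(p₁−1)} + c₂∇f/‖∇f‖^{(p₂−2)/(p₂−1)})` reaches the unique
critical point `x*` of `f` within the fixed time
`T_NM = 2^{1−α₁/2}/(c₁(2−α₁)) + 2^{1−α₂/2}/(c₂(α₂−2))`, uniformly in the initial condition. -/
theorem fixed_time_newton_flow
    {n : ℕ} (c₁ c₂ p₁ p₂ : ℝ) (hc₁ : 0 < c₁) (hc₂ : 0 < c₂)
    (hp₁ : 2 < p₁) (hp₂ : 1 < p₂) (hp₂' : p₂ < 2)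
    (α₁ α₂ : ℝ) (hα₁ : α₁ = 2 - (p₁ - 2) / (p₁ - 1)) (hα₂ : α₂ = 2 - (p₂ - 2) / (p₂ - 1))
    (f : EuclideanSpace ℝ (Fin n) → ℝ) (hf : ContDiff ℝ 2 f)
    (hinv : ∀ y : EuclideanSpace ℝ (Fin n), IsUnit (fderiv ℝ (gradient f) y))
    (xstar : EuclideanSpace ℝ (Fin n)) (hxstar : gradient f xstar = 0)
    (huniq : ∀ y, gradient f y = 0 → y = xstar)
    (x : ℝ → EuclideanSpace ℝ (Fin n))
    (hx : ∀ t : ℝ, 0 ≤ t → HasDerivAt x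
      (if gradient f (x t) = 0 then 0
       else -(Ring.inverse (fderiv ℝ (gradient f) (x t))
          ((c₁ / ‖gradient f (x t)‖ ^ ((p₁ - 2) / (p₁ - 1))) • gradient f (x t)
            + (c₂ / ‖gradient f (x t)‖ ^ ((p₂ - 2) / (p₂ - 1))) • gradient f (x t)))) t) :
    ∀ t : ℝ,
      2 ^ (1 - α₁ / 2) / (c₁ * (2 - α₁)) + 2 ^ (1 - α₂ / 2) / (c₂ * (α₂ - 2)) ≤ t →
      x t = xstar := by
  intro t ht
  apply huniq
  have hgd : Differentiable ℝ (gradient f) := by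
    have h1 : ContDiff ℝ 1 (fderiv ℝ f) := hf.fderiv_right (by norm_num)
    have h2 : Differentiable ℝ (fderiv ℝ f) := h1.differentiable (by norm_num)
    intro y
    exact ((InnerProductSpace.toDual ℝ
      (EuclideanSpace ℝ (Fin n))).symm.toContinuousLinearEquiv.differentiableAt).comp y (h2 y)
  have hb₁ : 0 < (p₁ - 2) / (p₁ - 1) := div_pos (by linarith) (by linarith)
  have hb₂ : (p₂ - 2) / (p₂ - 1) < 0 := div_neg_of_neg_of_pos (by linarith) (by linarith)
  generalize (p₁ - 2) / (p₁ - 1) = b₁ at *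
  generalize (p₂ - 2) / (p₂ - 1) = b₂ at *
  have key := aux_fixed_time (fun s => ‖gradient f (x s)‖ ^ 2) c₁ c₂ b₁ b₂ hc₁ hc₂ hb₁ hb₂
    (fun s => by positivity) ?_ t ?_
  · simpa using key
  · intro s hs
    have hg := ((hgd (x s)).hasFDerivAt.comp_hasDerivAt s (hx s hs)).norm_sq
    refine ⟨_, hg, ?_⟩
    by_cases h0 : gradient f (x s) = 0
    · simp [h0]
    · have hr : 0 < ‖gradient f (x s)‖ := norm_pos_iff.mpr h0
      have hinvapp : ∀ v, fderiv ℝ (gradient f) (x s)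
          (Ring.inverse (fderiv ℝ (gradient f) (x s)) v) = v := by
        intro v
        have := Ring.mul_inverse_cancel _ (hinv (x s))
        exact congrArg (fun L => L v) this
      have hpw : ∀ b : ℝ, (‖gradient f (x s)‖ ^ 2) ^ (1 - b / 2)
          = ‖gradient f (x s)‖ ^ 2 / ‖gradient f (x s)‖ ^ b := by
        intro b
        rw [← Real.rpow_natCast, ← Real.rpow_mul hr.le, ← Real.rpow_sub hr]
        congr 1
        push_cast
        ring
      have q1 : 0 < c₁ * (‖gradient f (x s)‖ ^ 2 / ‖gradient f (x s)‖ ^ b₁) := by positivity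
      have q2 : 0 < c₂ * (‖gradient f (x s)‖ ^ 2 / ‖gradient f (x s)‖ ^ b₂) := by positivity
      have hval : 2 * inner ℝ (gradient f (x s)) (fderiv ℝ (gradient f) (x s)
          (-(Ring.inverse (fderiv ℝ (gradient f) (x s))
          ((c₁ / ‖gradient f (x s)‖ ^ b₁) • gradient f (x s)
            + (c₂ / ‖gradient f (x s)‖ ^ b₂) • gradient f (x s))))) =
          -2 * (c₁ * (‖gradient f (x s)‖ ^ 2 / ‖gradient f (x s)‖ ^ b₁) +
            c₂ * (‖gradient f (x s)‖ ^ 2 / ‖gradient f (x s)‖ ^ b₂)) := by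
        rw [map_neg, hinvapp, inner_neg_right, inner_add_right, real_inner_smul_right,
          real_inner_smul_right, real_inner_self_eq_norm_sq]
        ring
      simp only [Function.comp_apply, if_neg h0]
      rw [hval, hpw, hpw]
      exact ⟨by linarith, fun _ => ⟨by linarith, by linarith⟩⟩
  · refine le_trans (le_of_eq ?_) ht
    subst hα₁ hα₂
    congr 2 <;> [congr 1; congr 1; congr 1; congr 1] <;> ring
end

section
/- Fix p > 2 and set β₁ = p/(2(p−1)). Let f satisfy the strong-convexity bound ⟪v, ∇²f(x) v⟫ ≥ k‖v‖² (k > 0). Suppose x : ℝ → ℝⁿ is differentiable at t with x'(t) = −∇f(x(t))/‖∇f(x(t))‖^{(p−2)/(p−1)} and ∇f(x(t)) ≠ 0. Then the function V ∘ x, where V(y) = ½‖∇f(y)‖², is differentiable at t and satisfies (V ∘ x)'(t) ≤ −k·2^{β₁}·(V(x(t)))^{β₁}. -/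
open scoped RealInnerProductSpace

/-- Lyapunov decrease for the modified gradient flow under strong convexity: along
`ẋ = −∇f(x)/‖∇f(x)‖^{(p−2)/(p−1)}`, `p > 2` (at a point where `∇f(x(t)) ≠ 0`),
`V(y) = ½‖∇f(y)‖²` satisfies `(V∘x)'(t) ≤ −k·2^{β₁}·V(x(t))^{β₁}` with `β₁ = p/(2(p−1))`. -/
theorem lyapunov_decrease_modified_flow_strong_convex
    {n : ℕ} (p : ℝ) (hp : 2 < p) (β₁ : ℝ) (hβ₁ : β₁ = p / (2 * (p - 1)))
    (f : EuclideanSpace ℝ (Fin n) → ℝ) (hf : ContDiff ℝ 2 f)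
    (k : ℝ) (hk : 0 < k)
    (hconv : ∀ x v : EuclideanSpace ℝ (Fin n),
      k * ‖v‖ ^ 2 ≤ ⟪v, fderiv ℝ (gradient f) x v⟫)
    (x : ℝ → EuclideanSpace ℝ (Fin n)) (t : ℝ)
    (hx : HasDerivAt x
      (-(‖gradient f (x t)‖ ^ ((p - 2) / (p - 1)))⁻¹ • gradient f (x t)) t)
    (hne : gradient f (x t) ≠ 0) :
    ∃ d : ℝ, HasDerivAt (fun s => (1 / 2) * ‖gradient f (x s)‖ ^ 2) d t ∧
      d ≤ -(k * 2 ^ β₁ * ((1 / 2) * ‖gradient f (x t)‖ ^ 2) ^ β₁) := by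
  have hg : Differentiable ℝ (gradient f) := by
    have h1 : Differentiable ℝ (fderiv ℝ f) :=
      (hf.fderiv_right (m := 1) (by norm_num)).differentiable (by norm_num)
    exact (InnerProductSpace.toDual ℝ (EuclideanSpace ℝ (Fin n))).symm.differentiable.comp h1
  have hcomp := ((hg (x t)).hasFDerivAt.comp_hasDerivAt t hx)
  have hV := (hcomp.norm_sq).const_mul (1 / 2 : ℝ)
  refine ⟨_, hV, ?_⟩
  have hc := hconv (x t) (gradient f (x t))
  simp only [Function.comp_apply, map_smul, inner_smul_right]
  have hpos : 0 < ‖gradient f (x t)‖ := norm_pos_iff.mpr hne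
  generalize ⟪gradient f (x t), fderiv ℝ (gradient f) (x t) (gradient f (x t))⟫ = q at hc ⊢
  generalize ‖gradient f (x t)‖ = r at hc hpos ⊢
  have hp1 : p - 1 ≠ 0 := by linarith
  have key : (2 : ℝ) ^ β₁ * ((1 / 2) * r ^ 2) ^ β₁ = (r ^ ((p - 2) / (p - 1)))⁻¹ * r ^ 2 := by
    rw [← Real.mul_rpow (by norm_num) (by positivity)]
    have : (2 : ℝ) * (1 / 2 * r ^ 2) = r ^ (2 : ℝ) := by
      rw [Real.rpow_two]; ring
    rw [this, ← Real.rpow_mul hpos.le, ← Real.rpow_neg hpos.le, ← Real.rpow_two,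
      ← Real.rpow_add hpos, hβ₁]
    congr 1
    field_simp
    ring
  rw [mul_assoc, key]
  have hcpos : 0 ≤ (r ^ ((p - 2) / (p - 1)))⁻¹ := by positivity
  have := mul_le_mul_of_nonneg_left hc hcpos
  linarith
end
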